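/- arXiv:2509.21948 — 3 statements merged into one kernel-verified Lean document; each statement's English description precedes it below -/
import Mathlib

section
/- Let b ≥ 2 be an integer. The sequence (ℓ_b(n!))_{n=1}^∞ of last nonzero digits of factorials in base b is eventually periodic if and only if b = 2. -/
/-- The "unit part" of `n` in base `b`: `n / b ^ v_b(n)` where `v_b(n)` is the largest
exponent `e` with `b ^ e ∣ n`. -/
def unitPart (b n : ℕ) : ℕ := n / b ^ padicValNat b n

/-- The last nonzero digit of `n` in base `b`: the unique integer `d` with `1 ≤ d ≤ b - 1`
and `d ≡ U_b(n) (mod b)`. -/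
def lnzd (b n : ℕ) : ℕ := unitPart b n % b

theorem pow_lt_pow_swap {q p : ℕ} (hq : 2 ≤ q) (hqp : q < p) : p ^ (q-1) < q ^ (p-1) := by
  have h1 : (1:ℝ) < q := by exact_mod_cast (by omega : 1 < q)
  have h2 : (q:ℝ) < p := by exact_mod_cast hqp
  have h := strictConcaveOn_log_Ioi.slope_anti_adjacent (x := 1) (y := q) (z := p)
    (by simp) (by simp; omega) h1 h2
  rw [Real.log_one, sub_zero, div_lt_div_iff₀ (by linarith) (by linarith)] at h
  have h3 : Real.log ((p:ℝ) ^ (q-1)) < Real.log ((q:ℝ) ^ (p-1)) := by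
    rw [Real.log_pow, Real.log_pow, Nat.cast_sub (by omega), Nat.cast_sub (by omega)]
    push_cast
    nlinarith
  have h4 := (Real.log_lt_log_iff (pow_pos (by linarith) _) (pow_pos (by linarith) _)).1 h3
  exact_mod_cast h4

theorem pow_dom (X Y E : ℕ) (h : X < Y) : ∃ K0, ∀ K ≥ K0, E * X ^ K < Y ^ K := by
  have hY : (0:ℝ) < Y := by exact_mod_cast (by omega : 0 < Y)
  have h1 : Filter.Tendsto (fun K : ℕ => (E:ℝ) * ((X:ℝ)/Y)^K) Filter.atTop (nhds (E * 0)) :=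
    (tendsto_pow_atTop_nhds_zero_of_lt_one (by positivity)
      ((div_lt_one hY).2 (by exact_mod_cast h))).const_mul _
  have h2 := h1.eventually_lt_const (u := 1) (by simp)
  obtain ⟨K0, hK0⟩ := Filter.eventually_atTop.1 h2
  refine ⟨K0, fun K hK => ?_⟩
  have h3 := hK0 K hK
  rw [div_pow, ← mul_div_assoc, div_lt_one (by positivity)] at h3
  exact_mod_cast h3

theorem dsum_le (q n : ℕ) (hq : 2 ≤ q) : (q.digits n).sum ≤ (q-1) * (q.digits n).length := by
  have := List.sum_le_card_nsmul (q.digits n) (q-1) (fun x hx => by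
    have := Nat.digits_lt_base (by omega) hx
    omega)
  simpa [mul_comm] using this

theorem dsum_div (p n : ℕ) (hp : 2 ≤ p) : (p.digits n).sum = n % p + (p.digits (n/p)).sum := by
  rcases Nat.eq_zero_or_pos n with rfl | hn
  · simp
  · rw [Nat.digits_def' (by omega) hn]; simp

theorem dsum_div_pow (p n k : ℕ) (hp : 2 ≤ p) : (p.digits (n/p^k)).sum ≤ (p.digits n).sum := by
  induction k with
  | zero => simp
  | succ k ih =>
    rw [pow_succ, ← Nat.div_div_eq_div_mul]
    have := dsum_div p (n/p^k) hp
    omega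

theorem dsum_pred (p c k : ℕ) (hp : 2 ≤ p) (hc : 0 < c) :
    (p-1) * k ≤ (p.digits (c * p^k - 1)).sum := by
  induction k with
  | zero => simp
  | succ k ih =>
    rw [dsum_div p _ hp]
    have h0 : 0 < c * p^k := by positivity
    have h : c * p^(k+1) - 1 = (p - 1) + p * (c * p^k - 1) := by
      obtain ⟨m, hm⟩ : ∃ m, c * p^k = m + 1 := ⟨_, (Nat.succ_pred_eq_of_pos h0).symm⟩
      rw [pow_succ, ← mul_assoc, hm]
      obtain ⟨r, rfl⟩ : ∃ r, p = r + 1 := ⟨p-1, by omega⟩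
      have : (m+1)*(r+1) = r + (r+1)*m + 1 := by ring
      simp [this]
    rw [h, Nat.add_mul_mod_self_left, Nat.mod_eq_of_lt (by omega : p - 1 < p),
      Nat.add_mul_div_left _ _ (by omega), Nat.div_eq_of_lt (by omega : p - 1 < p), zero_add]
    rw [mul_add]; omega

theorem dsum_low (p c K L t : ℕ) (hp : 2 ≤ p) (hc : 0 < c) (ht : 0 < t) (htL : t ≤ p^L)
    (hLK : L ≤ K) : (p-1) * (K-L) ≤ (p.digits (c * p^K - t)).sum := by
  refine le_trans (dsum_pred p c (K-L) hp hc) (le_trans (le_of_eq ?_) (dsum_div_pow p _ L hp))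
  congr 2
  symm
  have h0 : 0 < c * p^(K-L) := by positivity
  obtain ⟨m, hm⟩ : ∃ m, c * p^(K-L) = m + 1 := ⟨_, (Nat.succ_pred_eq_of_pos h0).symm⟩
  have : c * p^K = p^L * m + p^L := by
    obtain ⟨k, rfl⟩ := Nat.exists_eq_add_of_le hLK
    rw [Nat.add_sub_cancel_left] at hm
    rw [pow_add, mul_left_comm, hm]; ring
  have h2 : c * p^K - t = (p^L - t) + p^L * m := by omega
  rw [hm, h2, Nat.add_mul_div_left _ _ (by positivity), Nat.div_eq_of_lt (by omega)]
  simp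

/-- tie case -/
theorem tie_bound (p q c L : ℕ) (hq : 2 ≤ q) (hqp : q < p) (hc : 0 < c) :
    ∃ K0, ∀ K ≥ K0, ∀ t, 0 < t → t ≤ p^L → t < c * p^K →
      (q.digits (c*p^K - t)).sum ≤ (p.digits (c*p^K - t)).sum := by
  obtain ⟨K0, hK0⟩ := pow_dom (p^(q-1)) (q^(p-1)) ((q*c)^(q-1) * (q^(p-1))^L)
    (pow_lt_pow_swap hq hqp)
  refine ⟨max K0 L, fun K hK t ht htL htc => ?_⟩
  refine le_trans (dsum_le q _ hq) (le_trans ?_ (dsum_low p c K L t (by omega) hc ht htL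
    (le_trans (le_max_right _ _) hK)))
  by_contra hcon
  push Not at hcon
  set n := c*p^K - t with hn
  have h1 := Nat.base_pow_length_digits_le' (q-2) n (by omega)
  rw [show q - 2 + 2 = q by omega] at h1
  have h2 := hK0 K (le_trans (le_max_left _ _) hK)
  have h3 : q^((p-1)*(K-L)) ≤ q^((q-1)*(q.digits n).length) := Nat.pow_le_pow_right (by omega) hcon.le
  have h4 : q^((q-1)*(q.digits n).length) ≤ (q * (c * p^K))^(q-1) := by
    rw [mul_comm (q-1), pow_mul]
    exact Nat.pow_le_pow_left (h1.trans (Nat.mul_le_mul_left _ (by omega))) _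
  have h5 : (q^(p-1))^K = q^((p-1)*(K-L)) * (q^(p-1))^L := by
    rw [pow_mul, ← pow_add, Nat.sub_add_cancel (le_trans (le_max_right _ _) hK)]
  have h6 : (q * (c * p^K))^(q-1) = (q*c)^(q-1) * (p^(q-1))^K := by
    rw [← mul_assoc, mul_pow, ← pow_mul, ← pow_mul, mul_comm K]
  rw [h5] at h2
  have := Nat.mul_le_mul_right ((q^(p-1))^L) ((h3.trans h4).trans h6.le)
  nlinarith

theorem small_bound (q C : ℕ) (hq : 2 ≤ q) :
    ∃ n0, ∀ n ≥ n0, C * (q.digits n).sum ≤ n := by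
  have h1 := tendsto_pow_const_div_const_pow_of_one_lt 1 (one_lt_two (α := ℝ))
  have h2 : Filter.Tendsto (fun K : ℕ => ((C * q * q : ℕ):ℝ) * ((K:ℝ)^1/2^K)) Filter.atTop (nhds (((C * q * q:ℕ):ℝ) * 0)) :=
    h1.const_mul _
  obtain ⟨l0, hl0⟩ := Filter.eventually_atTop.1 (h2.eventually_lt_const (u := 1) (by simp))
  refine ⟨q^l0 + 1, fun n hn => ?_⟩
  have h3 : l0 ≤ (q.digits n).length := by
    by_contra hcon
    have : n < q^(q.digits n).length := Nat.lt_base_pow_length_digits (by omega)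
    have := Nat.pow_le_pow_right (by omega : 0 < q) (by omega : (q.digits n).length ≤ l0)
    omega
  have h4 := hl0 _ h3
  rw [← mul_div_assoc, div_lt_one (by positivity), pow_one] at h4
  have h5 : C * q * q * (q.digits n).length < 2 ^ (q.digits n).length := by exact_mod_cast h4
  have h6 := Nat.base_pow_length_digits_le' (q-2) n (by omega)
  rw [show q - 2 + 2 = q by omega] at h6
  have h7 := Nat.pow_le_pow_left hq (q.digits n).length
  have h8 : q * (C * q * (q.digits n).length) ≤ q * n := by nlinarith
  have h9 := Nat.le_of_mul_le_mul_left h8 (by omega)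
  refine le_trans ?_ h9
  have := dsum_le q n hq
  calc C * (q.digits n).sum ≤ C * ((q-1) * (q.digits n).length) := Nat.mul_le_mul_left _ this
    _ ≤ C * (q * (q.digits n).length) := by gcongr; omega
    _ = _ := by ring

theorem dominate_one (b p c L q : ℕ) (hc : 0 < c) (hp : p.Prime) (hq : q.Prime)
    (hap : 0 < b.factorization p)
    (hmax : b.factorization q * (q-1) < b.factorization p * (p-1) ∨
      (b.factorization q * (q-1) = b.factorization p * (p-1) ∧ q ≤ p)) :
    ∀ᶠ K in Filter.atTop, ∀ t, 0 < t → t ≤ p^L → t < c * p^K →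
      b.factorization q * (c*p^K - t).factorial.factorization p
        ≤ b.factorization p * (c*p^K - t).factorial.factorization q := by
  have hp2 := hp.two_le
  have hq2 := hq.two_le
  have key : ∀ n, b.factorization q * (q-1) * (n - (p.digits n).sum)
      ≤ b.factorization p * (p-1) * (n - (q.digits n).sum) →
      b.factorization q * n.factorial.factorization p
        ≤ b.factorization p * n.factorial.factorization q := by
    intro n h
    have := Fact.mk hp
    have := Fact.mk hq
    have h1 := sub_one_mul_padicValNat_factorial (p := p) n
    have h2 := sub_one_mul_padicValNat_factorial (p := q) n
    rw [Nat.factorization_def n.factorial hp, Nat.factorization_def n.factorial hq]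
    rw [← h1, ← h2] at h
    have h0 : 0 < (p-1)*(q-1) := Nat.mul_pos (by omega) (by omega)
    refine Nat.le_of_mul_le_mul_left ?_ h0
    calc _ = _ := by ring
      _ ≤ _ := h
      _ = _ := by ring
  rcases hmax with h | ⟨h, hle⟩
  · obtain ⟨n0, hn0⟩ := small_bound q (b.factorization p * (p-1)) hq2
    refine Filter.eventually_atTop.2 ⟨L + (n0+1), fun K hK t ht htL htc => key _ ?_⟩
    have hn : n0 ≤ c * p^K - t := by
      have h1 : p^L * p^(n0+1) ≤ p^K := by
        rw [← pow_add]; exact Nat.pow_le_pow_right (by omega) hK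
      have h2 : n0 + 1 < p^(n0+1) := Nat.lt_pow_self hp2
      have h3 : 0 < p^L := by positivity
      have h4 : p^K ≤ c * p^K := Nat.le_mul_of_pos_left _ hc
      have h5 : p^L + n0 ≤ p^L * p^(n0+1) := by nlinarith
      omega
    have hs := hn0 _ hn
    generalize c * p^K - t = n at *
    set X := b.factorization q * (q-1)
    set Y := b.factorization p * (p-1)
    have h1 : X * (n - (p.digits n).sum) ≤ X * n := Nat.mul_le_mul_left _ (Nat.sub_le _ _)
    rw [Nat.mul_sub Y]
    have h2 : (X+1) * n ≤ Y * n := Nat.mul_le_mul_right _ h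
    rw [add_mul] at h2
    omega
  · rcases hle.lt_or_eq with hlt | rfl
    · obtain ⟨K0, hK0⟩ := tie_bound p q c L hq2 hlt hc
      refine Filter.eventually_atTop.2 ⟨K0, fun K hK t ht htL htc => key _ ?_⟩
      have := hK0 K hK t ht htL htc
      rw [h]
      exact Nat.mul_le_mul_left _ (by omega)
    · exact Filter.Eventually.of_forall fun K t _ _ _ => le_rfl

theorem unitPart_spec (b m : ℕ) (hb : 2 ≤ b) (hm : m ≠ 0) :
    m = b ^ padicValNat b m * unitPart b m ∧ ¬ b ∣ unitPart b m := by
  have hfin : FiniteMultiplicity b m := Nat.finiteMultiplicity_iff.2 ⟨by omega, by omega⟩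
  have h1 : padicValNat b m = multiplicity b m := padicValNat_def' (by omega) hm
  have h2 : b ^ padicValNat b m ∣ m := by rw [h1]; exact pow_multiplicity_dvd b m
  refine ⟨(Nat.mul_div_cancel' h2).symm, fun h => ?_⟩
  have h3 : b ^ (padicValNat b m + 1) ∣ m := by
    conv_rhs => rw [← Nat.mul_div_cancel' h2]
    rw [pow_succ]
    exact Nat.mul_dvd_mul_left _ h
  rw [h1] at h3
  exact hfin.not_pow_dvd_of_multiplicity_lt (Nat.lt_succ_self _) h3

theorem unitPart_lt (b p m : ℕ) (hb : 2 ≤ b) (hm : m ≠ 0) (hap : 0 < b.factorization p)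
    (h : ∀ q ∈ b.primeFactors, b.factorization q * m.factorization p
        ≤ b.factorization p * m.factorization q) :
    unitPart b m ≠ 0 ∧ (unitPart b m).factorization p < b.factorization p := by
  obtain ⟨h1, h2⟩ := unitPart_spec b m hb hm
  have h0 : unitPart b m ≠ 0 := fun h => h2 (by simp [h])
  refine ⟨h0, ?_⟩
  by_contra hcon
  push Not at hcon
  apply h2
  rw [← Nat.factorization_prime_le_iff_dvd (by omega) h0]
  intro q hq
  by_cases hqb : q ∈ b.primeFactors
  · have h3 := h q hqb
    have hf : ∀ r, m.factorization r = padicValNat b m * b.factorization r +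
        (unitPart b m).factorization r := by
      intro r
      conv_lhs => rw [h1]
      rw [Nat.factorization_mul (by positivity) h0, Nat.factorization_pow]
      simp
    rw [hf, hf] at h3
    have h4 : b.factorization p * b.factorization q ≤ b.factorization p * (unitPart b m).factorization q := by
      have := Nat.mul_le_mul_left (b.factorization q) hcon
      nlinarith
    exact Nat.le_of_mul_le_mul_left h4 hap
  · rw [← Nat.support_factorization, Finsupp.notMem_support_iff] at hqb
    omega

theorem cong_split (b p u w : ℕ) (hp : p.Prime) (hu : u ≠ 0) (hw : w ≠ 0)
    (h : u % b = w % b) (h1 : u.factorization p < b.factorization p)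
    (h2 : w.factorization p < b.factorization p) :
    ∃ α r s, u = p^α * r ∧ w = p^α * s ∧ ¬ p ∣ r ∧ ¬ p ∣ s ∧ r ≡ s [MOD p] := by
  obtain ⟨α, r, hr, rfl⟩ := Nat.exists_eq_pow_mul_and_not_dvd hu p hp.ne_one
  obtain ⟨β, s, hs, rfl⟩ := Nat.exists_eq_pow_mul_and_not_dvd hw p hp.ne_one
  have hf : ∀ γ z, ¬ p ∣ z → (p^γ * z).factorization p = γ := by
    intro γ z hz
    rw [Nat.factorization_mul (pow_ne_zero _ hp.ne_zero) (fun h => hz (by simp [h])),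
      Nat.factorization_pow]
    simp [hp.factorization_self, Nat.factorization_eq_zero_of_not_dvd hz]
  rw [hf _ _ hr] at h1
  rw [hf _ _ hs] at h2
  have hd : ∀ γ < b.factorization p, p^(γ+1) ∣ b := fun γ hγ =>
    (pow_dvd_pow p hγ).trans (Nat.ordProj_dvd b p)
  have hm : p^α * r ≡ p^β * s [MOD b] := h
  have hpos : ∀ γ, 0 < p^γ := fun γ => pow_pos hp.pos γ
  rcases lt_trichotomy α β with hlt | rfl | hlt
  · exfalso
    have h3 := hm.of_dvd (hd α h1)
    have h4 : p^(α+1) ∣ p^β * s := Dvd.dvd.mul_right (pow_dvd_pow p hlt) _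
    have h5 := (h3.dvd_iff dvd_rfl).2 h4
    rw [pow_succ] at h5
    exact hr (Nat.dvd_of_mul_dvd_mul_left (hpos α) h5)
  · refine ⟨α, r, s, rfl, rfl, hr, hs, ?_⟩
    have h3 := hm.of_dvd (hd α h1)
    rw [pow_succ] at h3
    exact Nat.ModEq.mul_left_cancel' (hpos α).ne' h3
  · exfalso
    have h3 := hm.of_dvd (hd β h2)
    have h4 : p^(β+1) ∣ p^α * r := Dvd.dvd.mul_right (pow_dvd_pow p hlt) _
    have h5 := (h3.dvd_iff dvd_rfl).1 h4
    rw [pow_succ] at h5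
    exact hs (Nat.dvd_of_mul_dvd_mul_left (hpos β) h5)

set_option maxHeartbeats 1000000 in
theorem final_alg (b p l K A1 A2 B1 B2 e1 e2 f1 f2 : ℕ) (hp : p.Prime) (hb : b ≠ 0) (hl : l ≠ 0)
    (hK : 2 ≤ K)
    (hap : 0 < b.factorization p) (h2 : p = 2 → 2 ≤ b.factorization p)
    (hA1 : A1 ≠ 0) (hA2 : A2 ≠ 0) (hB1 : B1 ≠ 0) (hB2 : B2 ≠ 0)
    (hA : A1 % b = A2 % b) (hB : B1 % b = B2 % b)
    (vA1 : A1.factorization p < b.factorization p) (vA2 : A2.factorization p < b.factorization p)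
    (vB1 : B1.factorization p < b.factorization p) (vB2 : B2.factorization p < b.factorization p)
    (E1 : b^e1 * A1 = l * (p^K - 1) * (b^f1 * B1))
    (E2 : b^e2 * A2 = l * (p^K - 2) * (b^f2 * B2)) : False := by
  obtain ⟨α, r1, r2, rfl, rfl, hr1, hr2, hr⟩ := cong_split b p A1 A2 hp hA1 hA2 hA vA1 vA2
  obtain ⟨β, s1, s2, rfl, rfl, hs1, hs2, hs⟩ := cong_split b p B1 B2 hp hB1 hB2 hB vB1 vB2
  have hp2 := hp.two_le
  have hpK : p^2 ≤ p^K := Nat.pow_le_pow_right (by omega) hK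
  have hpK4 : 2 < p^K := by
    have : 2 * 2 ≤ p * p := Nat.mul_le_mul hp2 hp2
    rw [pow_two] at hpK
    omega
  have hpK' : p ∣ p^K := dvd_pow_self p (by omega)
  have hy1 : ¬ p ∣ p^K - 1 := by
    intro h
    have := (Nat.dvd_sub_iff_right (by omega) hpK').1 h
    have := Nat.le_of_dvd one_pos this
    omega
  have hne1 : p^K - 1 ≠ 0 := fun h => hy1 (by simp [h])
  have hne2 : p^K - 2 ≠ 0 := by
    have : 2 < p^2 := by nlinarith
    omega
  have hf : ∀ γ z, ¬ p ∣ z → (p^γ * z).factorization p = γ := by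
    intro γ z hz
    rw [Nat.factorization_mul (pow_ne_zero _ hp.ne_zero) (fun h => hz (by simp [h])),
      Nat.factorization_pow]
    simp [hp.factorization_self, Nat.factorization_eq_zero_of_not_dvd hz]
  have hF : ∀ e f y r s, ¬ p ∣ r → ¬ p ∣ s → y ≠ 0 →
      b^e * (p^α * r) = l * y * (b^f * (p^β * s)) →
      e * b.factorization p + α = l.factorization p + y.factorization p +
        (f * b.factorization p + β) := by
    intro e f y r s hr hs hy h
    have hr0 : p^α * r ≠ 0 := mul_ne_zero (pow_ne_zero _ hp.ne_zero) (fun h => hr (by simp [h]))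
    have hs0 : p^β * s ≠ 0 := mul_ne_zero (pow_ne_zero _ hp.ne_zero) (fun h => hs (by simp [h]))
    have F := congrArg (fun z => z.factorization p) h
    beta_reduce at F
    rw [Nat.factorization_mul (by positivity) hr0,
      Nat.factorization_mul (mul_ne_zero hl hy) (mul_ne_zero (by positivity) hs0),
      Nat.factorization_mul hl hy, Nat.factorization_mul (by positivity) hs0] at F
    simp only [Finsupp.add_apply] at F
    rw [hf _ _ hr, hf _ _ hs, Nat.factorization_pow, Nat.factorization_pow] at F
    simpa using F
  have F1 := hF _ _ _ _ _ hr1 hs1 hne1 E1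
  have F2 := hF _ _ _ _ _ hr2 hs2 hne2 E2
  rw [Nat.factorization_eq_zero_of_not_dvd hy1] at F1
  rcases hp.eq_two_or_odd' with rfl | hodd
  · have h3 : (2^K - 2).factorization 2 = 1 := by
      obtain ⟨k, rfl⟩ : ∃ k, K = k + 2 := ⟨K - 2, by omega⟩
      have h4 : 2^(k+2) - 2 = 2^1 * (2^(k+1) - 1) := by
        rw [pow_succ 2 (k+1)]; omega
      rw [h4]
      apply hf
      have : 0 < 2^k := by positivity
      rw [pow_succ]
      omega
    rw [h3] at F2
    have ha := h2 rfl
    have hd : (b.factorization 2) * (e2 + f1) = b.factorization 2 * (e1 + f2) + 1 := by nlinarith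
    have h5 : b.factorization 2 ∣ 1 :=
      (Nat.dvd_add_right (dvd_mul_right _ (e1 + f2))).1 (hd ▸ dvd_mul_right _ _)
    have := Nat.le_of_dvd one_pos h5
    omega
  · have hp3 : ¬ p ∣ 2 := by
      intro h
      have := Nat.le_of_dvd two_pos h
      obtain ⟨k, hk⟩ := hodd
      omega
    have hy2 : ¬ p ∣ p^K - 2 := by
      intro h
      exact hp3 ((Nat.dvd_sub_iff_right (by omega) hpK').1 h)
    rw [Nat.factorization_eq_zero_of_not_dvd hy2] at F2
    have hd : (b.factorization p) * (e2 + f1) = b.factorization p * (e1 + f2) := by linarith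
    have hd := Nat.eq_of_mul_eq_mul_left hap hd
    have hc0 : 0 < b^(e1+f2) * p^α * p^β * l := by
      have := hp.pos
      positivity
    have hX : r1 * s2 * (p^K - 2) = r2 * s1 * (p^K - 1) := by
      refine Nat.eq_of_mul_eq_mul_left hc0 ?_
      calc _ = (b^e1 * (p^α * r1)) * (l * (p^K-2) * (b^f2 * (p^β * s2))) := by ring
        _ = (l * (p^K-1) * (b^f1 * (p^β * s1))) * (b^e2 * (p^α * r2)) := by rw [E1, E2]
        _ = b^(e2+f1) * p^α * p^β * l * (r2 * s1 * (p^K-1)) := by ring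
        _ = _ := by rw [hd]
    have hrs : r1 * s2 ≡ r2 * s1 [MOD p] := hr.mul hs.symm
    have hX' : r1 * s2 * (p^K - 2) ≡ r1 * s2 * (p^K - 1) [MOD p] := by
      rw [hX]; exact hrs.symm.mul_right _
    have hcop : Nat.gcd p (r1 * s2) = 1 := by
      rw [← Nat.coprime_iff_gcd_eq_one]
      exact (hp.coprime_iff_not_dvd).2 (fun h => (hp.dvd_mul.1 h).elim hr1 hs2)
    have hY := Nat.ModEq.cancel_left_of_coprime hcop hX'
    rw [Nat.modEq_iff_dvd' (by omega)] at hY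
    have h6 : p^K - 1 - (p^K - 2) = 1 := by
      have : 2 < p^2 := by nlinarith
      omega
    rw [h6] at hY
    have := Nat.le_of_dvd one_pos hY
    omega

theorem not_periodic (b : ℕ) (hb : 2 ≤ b) (hb2 : b ≠ 2) (N l : ℕ) (hl : 1 ≤ l)
    (h : ∀ n ≥ N, lnzd b (Nat.factorial (n + l)) = lnzd b (Nat.factorial n)) : False := by
  have hne : b.primeFactors.Nonempty := Nat.nonempty_primeFactors.2 (by omega)
  obtain ⟨p, hpm, hmax⟩ := Finset.exists_max_image b.primeFactors
    (fun q => toLex (b.factorization q * (q-1), q)) hne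
  have hp := Nat.prime_of_mem_primeFactors hpm
  have hp2 := hp.two_le
  have hpos : ∀ q ∈ b.primeFactors, 0 < b.factorization q := fun q hq =>
    (Nat.prime_of_mem_primeFactors hq).factorization_pos_of_dvd (by omega)
      (Nat.dvd_of_mem_primeFactors hq)
  have hap := hpos p hpm
  have hmax' : ∀ q ∈ b.primeFactors, b.factorization q * (q-1) < b.factorization p * (p-1) ∨
      (b.factorization q * (q-1) = b.factorization p * (p-1) ∧ q ≤ p) := by
    intro q hq
    have := hmax q hq
    rwa [Prod.Lex.toLex_le_toLex] at this
  have h2 : p = 2 → 2 ≤ b.factorization p := by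
    rintro rfl
    by_contra hcon
    have h1 : b.factorization 2 = 1 := by omega
    apply hb2
    have hs : b.primeFactors = {2} := by
      refine Finset.eq_singleton_iff_unique_mem.2 ⟨hpm, fun q hq => ?_⟩
      have hq2 := (Nat.prime_of_mem_primeFactors hq).two_le
      have hqa := hpos q hq
      rcases hmax' q hq with h | h
      · rw [h1] at h
        have := Nat.mul_pos hqa (by omega : 0 < q - 1)
        omega
      · omega
    have := Nat.prod_primeFactors_pow_factorization (n := b) (by omega)
    rw [hs] at this
    simp [h1] at this
    exact this
  have hdom := (Filter.eventually_all_finset b.primeFactors).2 (fun q hq =>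
    dominate_one b p l (2 * l + 1) q hl hp (Nat.prime_of_mem_primeFactors hq) hap (hmax' q hq))
  obtain ⟨K, hdom, hK⟩ := (hdom.and (Filter.eventually_ge_atTop (N + 2 * l + 3))).exists
  have hKp : K < p^K := Nat.lt_pow_self hp2
  have hlK : p^K ≤ l * p^K := Nat.le_mul_of_pos_left _ hl
  have hL : 2 * l + 1 < p^(2*l+1) := Nat.lt_pow_self hp2
  have hlK2 : l * K ≤ l * p^K := Nat.mul_le_mul_left _ hKp.le
  have spec : ∀ t, 0 < t → t ≤ 2 * l + 1 →
      unitPart b (l*p^K - t).factorial ≠ 0 ∧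
      (unitPart b (l*p^K - t).factorial).factorization p < b.factorization p := fun t ht htl =>
    unitPart_lt b p _ hb (Nat.factorial_ne_zero _) hap
      (fun q hq => hdom q hq t ht (by omega) (by omega))
  have eqn : ∀ x, 0 < x → x ≤ 2 →
      b ^ padicValNat b (l*p^K - l*x).factorial * unitPart b (l*p^K - l*x).factorial
      = l * (p^K - x) * (b ^ padicValNat b (l*p^K - (l*x+1)).factorial *
        unitPart b (l*p^K - (l*x+1)).factorial) := by
    intro x hx hx2
    rw [← (unitPart_spec b _ hb (Nat.factorial_ne_zero _)).1,
      ← (unitPart_spec b _ hb (Nat.factorial_ne_zero _)).1, Nat.mul_sub]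
    have : l * x ≤ l * 2 := Nat.mul_le_mul_left _ hx2
    have e : l*p^K - l*x = (l*p^K - (l*x+1)) + 1 := by omega
    rw [e, Nat.factorial_succ]
  have s1 := spec (l*1) (by omega) (by omega)
  have s2 := spec (l*2) (by omega) (by omega)
  have s3 := spec (l*1+1) (by omega) (by omega)
  have s4 := spec (l*2+1) (by omega) (by omega)
  have hA := h (l*p^K - l*2) (by omega)
  have hB := h (l*p^K - (l*2+1)) (by omega)
  rw [show l*p^K - l*2 + l = l*p^K - l*1 by omega] at hA
  rw [show l*p^K - (l*2+1) + l = l*p^K - (l*1+1) by omega] at hB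
  exact final_alg b p l K _ _ _ _ _ _ _ _ hp (by omega) (by omega) (by omega) hap h2
    s1.1 s2.1 s3.1 s4.1 hA hB s1.2 s2.2 s3.2 s4.2
    (eqn 1 (by omega) (by omega)) (eqn 2 (by omega) (by omega))

/-- The sequence of last nonzero digits of factorials in base `b ≥ 2` is eventually
periodic if and only if `b = 2`. -/
theorem lnzd_factorial_eventuallyPeriodic_iff (b : ℕ) (hb : 2 ≤ b) :
    (∃ N ≥ 1, ∃ l ≥ 1, ∀ n ≥ N, lnzd b (Nat.factorial (n + l)) = lnzd b (Nat.factorial n))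
      ↔ b = 2 := by
  constructor
  · rintro ⟨N, _, l, hl, h⟩
    by_contra hb2
    exact not_periodic b hb hb2 N l hl h
  · rintro rfl
    refine ⟨1, le_rfl, 1, le_rfl, fun n _ => ?_⟩
    have h1 := (unitPart_spec 2 _ hb (Nat.factorial_ne_zero (n+1))).2
    have h2 := (unitPart_spec 2 _ hb (Nat.factorial_ne_zero n)).2
    unfold lnzd
    omega
end

section
/- Let k ≥ 2 and let a = (a_n)_{n≥1} be the sequence produced by a k-automaton A = (Q, Σ_k, δ, q_0, Δ, τ) with δ(q_0, 0) = q_0, i.e. a_n = τ(δ(q_0, (n)_k)) for all n ≥ 1. Then a is (ω, M)-stammering with ω = 1 + 1/|Q| and M = |Q| − 1, where |Q| is the number of states of A. In particular, every k-automatic sequence is stammering. -/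
open Filter

/-- `W^x` for a finite word `W` and a real `x > 0`: `⌊x⌋` copies of `W` followed by the
prefix of `W` of length `⌈(x - ⌊x⌋)·|W|⌉`. -/
noncomputable def wordPow {α : Type*} (W : List α) (x : ℝ) : List α :=
  (List.replicate ⌊x⌋₊ W).flatten ++ W.take ⌈Int.fract x * W.length⌉₊

/-- A finite word `W` is a prefix of the infinite word `a₁ a₂ a₃ ⋯`. -/
def IsPrefixOfSeq {α : Type*} (W : List α) (a : ℕ → α) : Prop :=
  ∀ (j : ℕ) (h : j < W.length), W.get ⟨j, h⟩ = a (j + 1)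

/-- The infinite word `a₁ a₂ a₃ ⋯` is `(ω, M)`-stammering: there are sequences of finite
words `(Uₙ)`, `(Vₙ)` such that `Uₙ Vₙ^ω` is a prefix of `a` for all `n`, `|Uₙ|/|Vₙ| ≤ M`
for all sufficiently large `n`, and `|Vₙ| → ∞`. -/
def IsStammering {α : Type*} (ω M : ℝ) (a : ℕ → α) : Prop :=
  ∃ U V : ℕ → List α,
    (∀ n : ℕ, 1 ≤ n → IsPrefixOfSeq (U n ++ wordPow (V n) ω) a) ∧
    (∃ N : ℕ, ∀ n ≥ N, ((U n).length : ℝ) ≤ M * ((V n).length : ℝ)) ∧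
    Tendsto (fun n => (V n).length) atTop atTop

/-- A `k`-automaton with state set `Q`, output alphabet `Δ`, transition function `trans`
(reading digits in `{0, …, k-1} ⊆ ℕ`), initial state `start` and output function `out`. -/
structure KAutomaton (Q Δ : Type*) where
  trans : Q → ℕ → Q
  start : Q
  out : Q → Δ

/-- The extension of the transition function to words of digits, read most significant
digit first. -/
def KAutomaton.run {Q Δ : Type*} (A : KAutomaton Q Δ) (q : Q) (w : List ℕ) : Q :=
  w.foldl A.trans q

/-- The sequence produced by a `k`-automaton: `a n = τ(δ(q₀, (n)_k))`, where `(n)_k` is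
the base-`k` representation of `n`, most significant digit first. -/
def KAutomaton.seq {Q Δ : Type*} (A : KAutomaton Q Δ) (k n : ℕ) : Δ :=
  A.out (A.run A.start (Nat.digits k n).reverse)


theorem stam_core {α : Type*} (a : ℕ → α) (s : ℕ) (hs : 2 ≤ s) (p v : ℕ → ℕ)
    (hp : ∀ n, 1 ≤ p n) (hpv : ∀ n, p n ≤ (s - 1) * v n + 1)
    (hrep : ∀ n t, s * t < v n → a (p n + t) = a (p n + v n + t))
    (hv : Tendsto v atTop atTop) :
    IsStammering (1 + 1 / (s : ℝ)) ((s : ℝ) - 1) a := by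
  have hs' : (2 : ℝ) ≤ s := by exact_mod_cast hs
  have h1 : 0 < 1 / (s : ℝ) := by positivity
  have h2 : 1 / (s : ℝ) < 1 := by
    rw [div_lt_one (by linarith)]; linarith
  have hfl : ⌊1 + 1 / (s : ℝ)⌋₊ = 1 := by
    rw [Nat.floor_eq_iff (by positivity)]
    push_cast
    constructor <;> linarith
  have hfr : Int.fract (1 + 1 / (s : ℝ)) = 1 / (s : ℝ) := by
    rw [Int.fract_one_add]
    exact Int.fract_eq_self.2 ⟨h1.le, h2⟩
  refine ⟨fun n => (List.range (p n - 1)).map (fun t => a (t + 1)),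
    fun n => (List.range (v n)).map (fun t => a (p n + t)), ?_, ⟨0, ?_⟩, ?_⟩
  · intro n _ j hj
    have hpn := hp n
    simp only [wordPow, hfl, hfr, List.replicate_one, List.flatten_cons, List.flatten_nil,
      List.append_nil, List.length_map, List.length_range, List.get_eq_getElem,
      List.length_append, List.length_take] at hj ⊢
    by_cases c1 : j < p n - 1
    · rw [List.getElem_append_left (by simpa using c1)]
      simp
    · rw [List.getElem_append_right (by simpa using c1)]
      by_cases c2 : j - (p n - 1) < v n
      · rw [List.getElem_append_left (by simpa using c2)]
        simp only [List.getElem_map, List.getElem_range, List.length_map, List.length_range]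
        congr 1
        omega
      · rw [List.getElem_append_right (by simpa using c2)]
        simp only [List.getElem_map, List.getElem_range, List.length_map, List.length_range,
          List.getElem_take]
        have h3 : j - (p n - 1) - v n < ⌈1 / (s : ℝ) * (v n : ℝ)⌉₊ := by omega
        rw [Nat.lt_ceil, one_div, inv_mul_eq_div, lt_div_iff₀ (by linarith)] at h3
        have h4 : s * (j - (p n - 1) - v n) < v n := by
          rw [mul_comm]; exact_mod_cast h3
        rw [hrep n _ h4]
        congr 1
        omega
  · intro n _
    simp only [List.length_map, List.length_range]
    have h := hpv n
    have h3 : p n - 1 ≤ (s - 1) * v n := by omega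
    have h4 : ((p n - 1 : ℕ) : ℝ) ≤ (((s - 1) * v n : ℕ) : ℝ) := by exact_mod_cast h3
    rw [Nat.cast_mul, Nat.cast_sub (by omega : 1 ≤ s)] at h4
    simpa using h4
  · simpa using hv

theorem stam_step {Q Δ : Type*} (k : ℕ) (hk : 2 ≤ k)
    (A : KAutomaton Q Δ) (h0 : A.trans A.start 0 = A.start) (n d : ℕ) (hd : d < k) :
    A.run A.start (Nat.digits k (k * n + d)).reverse
      = A.trans (A.run A.start (Nat.digits k n).reverse) d := by
  by_cases h : n = 0 ∧ d = 0
  · obtain ⟨rfl, rfl⟩ := h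
    simp [KAutomaton.run, h0]
  · rw [add_comm, Nat.digits_add k (by omega) d n hd (by tauto)]
    simp [KAutomaton.run]

theorem stam_block {Q Δ : Type*} (k : ℕ) (hk : 2 ≤ k)
    (A : KAutomaton Q Δ) (h0 : A.trans A.start 0 = A.start) (q : ℕ → Q)
    (hq : q = fun n => A.run A.start (Nat.digits k n).reverse) (i j : ℕ) (hij : q i = q j) :
    ∀ m r, r < k ^ m → q (k ^ m * i + r) = q (k ^ m * j + r) := by
  have hst : ∀ n d, d < k → q (k * n + d) = A.trans (q n) d := by
    subst hq
    exact stam_step k hk A h0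
  intro m
  induction m with
  | zero => intro r hr; simp at hr; subst hr; simpa using hij
  | succ m ih =>
    intro r hr
    have e : ∀ x, k ^ (m + 1) * x + r = k * (k ^ m * x + r / k) + r % k := by
      intro x
      have := Nat.div_add_mod r k
      calc k ^ (m + 1) * x + r = k ^ (m + 1) * x + (k * (r / k) + r % k) := by rw [this]
        _ = _ := by ring
    have hm := Nat.mod_lt r (by omega : 0 < k)
    rw [e, e, hst _ _ hm, hst _ _ hm, ih]
    apply Nat.div_lt_of_lt_mul
    rw [pow_succ] at hr
    linarith [mul_comm k (k ^ m)]

theorem stam_pair {Q Δ : Type*} (k : ℕ) (hk : 2 ≤ k) (s : ℕ) (hs : 2 ≤ s)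
    (A : KAutomaton Q Δ) (h0 : A.trans A.start 0 = A.start) (q : ℕ → Q)
    (hq : q = fun n => A.run A.start (Nat.digits k n).reverse) (i d L : ℕ) (hd : 1 ≤ d)
    (heq : ∀ t, t < L → q (i + t) = q (i + d + t))
    (hc : (1 ≤ i ∧ i ≤ (s - 1) * d ∧ d ≤ s * L) ∨ (i = 0 ∧ d < s * L)) :
    IsStammering (1 + 1 / (s : ℝ)) ((s : ℝ) - 1) (fun n => A.seq k n) := by
  have hseq : ∀ n, A.seq k n = A.out (q n) := by intro n; subst hq; rfl
  have hK : ∀ n, n + s < k ^ (n + s) := fun n => Nat.lt_pow_self (by omega)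
  -- equality on long blocks
  have key : ∀ m t, t < k ^ m * L → q (k ^ m * i + t) = q (k ^ m * i + k ^ m * d + t) := by
    intro m t ht
    have hu : t / k ^ m < L := Nat.div_lt_of_lt_mul ht
    have hb := stam_block k hk A h0 q hq _ _ (heq _ hu) m (t % k ^ m)
      (Nat.mod_lt _ (by positivity))
    have hdm := Nat.div_add_mod t (k ^ m)
    have e1 : k ^ m * (i + t / k ^ m) + t % k ^ m = k ^ m * i + t := by
      rw [mul_add]; omega
    have e2 : k ^ m * (i + d + t / k ^ m) + t % k ^ m = k ^ m * i + k ^ m * d + t := by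
      rw [mul_add, mul_add]; omega
    rwa [e1, e2] at hb
  have hv : Tendsto (fun n => k ^ (n + s) * d) atTop atTop := by
    refine tendsto_atTop_mono (fun n => ?_) tendsto_id
    have := hK n
    simp only [id]
    nlinarith
  rcases hc with ⟨hi, hi2, hdl⟩ | ⟨rfl, hdl⟩
  · refine stam_core _ s hs (fun n => k ^ (n + s) * i) (fun n => k ^ (n + s) * d) ?_ ?_ ?_ hv
    · intro n
      have := hK n
      show 1 ≤ k ^ (n + s) * i
      nlinarith
    · intro n
      show k ^ (n + s) * i ≤ (s - 1) * (k ^ (n + s) * d) + 1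
      have := Nat.mul_le_mul_left (k ^ (n + s)) hi2
      calc _ ≤ _ := this
        _ = (s - 1) * (k ^ (n + s) * d) := by ring
        _ ≤ _ := Nat.le_succ _
    · intro n t ht
      simp only [hseq] at ht ⊢
      rw [key]
      have := Nat.mul_le_mul_left (k ^ (n + s)) hdl
      apply Nat.lt_of_mul_lt_mul_left (a := s)
      calc _ < _ := ht
        _ ≤ _ := this
        _ = _ := by ring
  · refine stam_core _ s hs (fun n => 1) (fun n => k ^ (n + s) * d) ?_ ?_ ?_ hv
    · intro n; exact le_rfl
    · intro n; exact Nat.le_add_left _ _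
    · intro n t ht
      simp only [hseq] at ht ⊢
      have h := key (n + s) (1 + t) ?_
      · rw [mul_zero, zero_add, zero_add] at h
        rw [h]
        congr 2
        omega
      · have h1 := hK n
        have := Nat.mul_le_mul_left (k ^ (n + s)) (Nat.succ_le_of_lt hdl)
        apply Nat.lt_of_mul_lt_mul_left (a := s)
        calc s * (1 + t) = s * t + s := by ring
          _ < k ^ (n + s) * d + k ^ (n + s) := by omega
          _ = k ^ (n + s) * (d + 1) := by ring
          _ ≤ _ := this
          _ = _ := by ring

theorem stam_const {α : Type*} (a : ℕ → α) (c : α) (h : ∀ n, a n = c) (ω : ℝ) :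
    IsStammering ω 0 a := by
  refine ⟨fun _ => [], fun n => List.replicate n c, ?_, ⟨0, by simp⟩, ?_⟩
  · intro n _ j hj
    rw [h]
    have hm := List.get_mem ([] ++ wordPow (List.replicate n c) ω) ⟨j, hj⟩
    generalize List.get ([] ++ wordPow (List.replicate n c) ω) ⟨j, hj⟩ = x at hm
    rw [List.nil_append, wordPow, List.mem_append] at hm
    rcases hm with hm | hm
    · rw [List.mem_flatten] at hm
      obtain ⟨l, hl, hx⟩ := hm
      rw [List.eq_of_mem_replicate hl] at hx
      exact List.eq_of_mem_replicate hx
    · exact List.eq_of_mem_replicate (List.mem_of_mem_take hm)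
  · simp only [List.length_replicate]
    exact tendsto_id

theorem automatic_seq_isStammering {Q Δ : Type*} [Fintype Q] (k : ℕ) (hk : 2 ≤ k)
    (A : KAutomaton Q Δ) (h0 : A.trans A.start 0 = A.start) :
    IsStammering (1 + 1 / (Fintype.card Q : ℝ)) ((Fintype.card Q : ℝ) - 1)
      (fun n => A.seq k n) := by
  have hpos : 0 < Fintype.card Q := Fintype.card_pos_iff.2 ⟨A.start⟩
  by_cases hs1 : Fintype.card Q = 1
  · have hsub : Subsingleton Q := Fintype.card_le_one_iff_subsingleton.1 hs1.le
    rw [hs1]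
    have := stam_const (fun n => A.seq k n) (A.out A.start)
      (fun n => congrArg A.out (Subsingleton.elim _ _)) (1 + 1 / ((1 : ℕ) : ℝ))
    simpa using this
  obtain ⟨s, hs⟩ : ∃ s, s = Fintype.card Q := ⟨_, rfl⟩
  rw [← hs]
  have hs2 : 2 ≤ s := by omega
  obtain ⟨q, hq⟩ : ∃ q : ℕ → Q, q = fun n => A.run A.start (Nat.digits k n).reverse := ⟨_, rfl⟩
  by_contra hcon
  have hpair := fun i d L hd heq hc =>
    hcon (stam_pair k hk s hs2 A h0 q hq i d L hd heq hc)
  have hpair1 : ∀ i d, 1 ≤ i → 1 ≤ d → i ≤ (s - 1) * d → d ≤ s → q i ≠ q (i + d) := by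
    intro i d hi hd hid hds he
    refine hpair i d 1 hd ?_ (Or.inl ⟨hi, hid, by omega⟩)
    intro t ht
    obtain rfl : t = 0 := by omega
    exact he
  have hpair0 : ∀ d, 1 ≤ d → d < s → q 0 ≠ q d := by
    intro d hd hds he
    refine hpair 0 d 1 hd ?_ (Or.inr ⟨rfl, by omega⟩)
    intro t ht
    obtain rfl : t = 0 := by omega
    simpa using he
  have hlt : ∀ i j, 1 ≤ i → i < s → i < j → j ≤ i + s → q i ≠ q j := by
    intro i j hi his hij hjs
    have := hpair1 i (j - i) hi (by omega) ?_ (by omega)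
    · rwa [Nat.add_sub_cancel' hij.le] at this
    · calc i ≤ (s - 1) * 1 := by omega
        _ ≤ _ := Nat.mul_le_mul_left _ (by omega)
  have hne : ∀ i j, i < j → j < s → q i ≠ q j := by
    intro i j hij hj
    rcases Nat.eq_zero_or_pos i with rfl | hi
    · exact hpair0 j hij hj
    · exact hlt i j hi (by omega) hij (by omega)
  have hinj : Function.Injective (fun i : Fin s => q i) := by
    intro i j hij
    by_contra hc
    rcases lt_or_gt_of_ne (fun h => hc (Fin.ext h) : (i : ℕ) ≠ j) with h | h
    · exact hne _ _ h j.2 hij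
    · exact hne _ _ h i.2 hij.symm
  have hsurj : ∀ x : Q, ∃ t, t < s ∧ q t = x := by
    intro x
    have hb := (Fintype.bijective_iff_injective_and_card (fun i : Fin s => q i)).2
      ⟨hinj, by simp [hs]⟩
    obtain ⟨t, ht⟩ := hb.2 x
    exact ⟨t, t.2, ht⟩
  have hA : q 0 = q s := by
    obtain ⟨t, ht, e⟩ := hsurj (q s)
    rcases Nat.eq_zero_or_pos t with rfl | h
    · exact e
    · exact absurd e (hlt t s h ht ht (by omega))
  have hB : q 0 = q (s + 1) := by
    obtain ⟨t, ht, e⟩ := hsurj (q (s + 1))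
    rcases Nat.eq_zero_or_pos t with rfl | h
    · exact e
    · exact absurd e (hlt t (s + 1) h ht (by omega) (by omega))
  obtain ⟨t, ht, e⟩ := hsurj (q (s + 2))
  rcases (by omega : t = 0 ∨ t = 1 ∨ 2 ≤ t) with rfl | rfl | h
  · exact hpair1 s 2 (by omega) (by omega) (by omega) hs2 (hA.symm.trans e)
  · refine hpair 0 (s + 1) 2 (by omega) ?_ (Or.inr ⟨rfl, by omega⟩)
    intro t ht
    rcases (by omega : t = 0 ∨ t = 1) with rfl | rfl
    · simpa using hB
    · rw [e]; congr 1; omega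
  · exact hlt t (s + 2) (by omega) ht (by omega) (by omega) e
end

section
/- Let q be a prime, a ≥ 1 and K ≥ 1 integers with gcd(q, K) = 1, and set b = q^a·K. Let i ≥ 0 be an integer, L an integer with gcd(L, b) = 1 and L ≥ 1, μ an integer with μ ≥ a(i+1), and u ≥ 0 an integer with K^i dividing 1 + u. Put N = q^μ(1 + u) + q^{a i} K^i L. Then v_b(N) = i and ℓ_b(N) ≡ L (mod q^a). -/
/-- Let `q` be prime, `a, K ≥ 1` with `gcd(q, K) = 1`, `b = q^a K`. Let `i ≥ 0`, `L ≥ 1`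
coprime to `b`, `μ ≥ a(i+1)`, and `u ≥ 0` with `K^i ∣ 1 + u`. Then for
`N = q^μ(1+u) + q^{ai} K^i L` we have `v_b(N) = i` and `ℓ_b(N) ≡ L (mod q^a)`. -/
theorem valuation_and_lnzd_of_special_form (q : ℕ) (hq : q.Prime) (a K : ℕ)
    (ha : 1 ≤ a) (hK : 1 ≤ K) (hco : Nat.Coprime q K) (b : ℕ) (hb : b = q ^ a * K)
    (i : ℕ) (L : ℕ) (hL : 1 ≤ L) (hLb : Nat.Coprime L b)
    (μ : ℕ) (hμ : a * (i + 1) ≤ μ)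
    (u : ℕ) (hu : K ^ i ∣ 1 + u)
    (N : ℕ) (hN : N = q ^ μ * (1 + u) + q ^ (a * i) * K ^ i * L) :
    padicValNat b N = i ∧ Nat.ModEq (q ^ a) (lnzd b N) L := by
  obtain ⟨w, hw⟩ := hu
  obtain ⟨c, hc⟩ := Nat.exists_eq_add_of_le hμ
  have hM : N = b ^ i * (q ^ a * (q ^ c * w) + L) := by
    rw [hN, hw, hb, hc, mul_pow, ← pow_mul, mul_add a i 1]
    ring
  have hbpos : 0 < b := by
    rw [hb]; exact Nat.mul_pos (pow_pos hq.pos _) hK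
  have hqb : q ∣ b := by
    rw [hb]; exact Dvd.dvd.mul_right (dvd_pow_self q (by omega)) K
  have hb1 : b ≠ 1 := by
    rintro h
    rw [h] at hqb
    exact hq.one_lt.ne' (Nat.dvd_one.mp hqb)
  have hqL : ¬ q ∣ L := fun h =>
    hq.one_lt.ne' (Nat.dvd_one.mp (hLb ▸ Nat.dvd_gcd h hqb))
  have hnd : ¬ b ∣ q ^ a * (q ^ c * w) + L := by
    intro h
    have h1 : q ∣ q ^ a * (q ^ c * w) :=
      Dvd.dvd.mul_right (dvd_pow_self q (by omega)) _
    exact hqL ((Nat.dvd_add_right h1).mp (hqb.trans h))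
  have hN0 : N ≠ 0 := by
    rw [hM]; exact (Nat.mul_pos (pow_pos hbpos _) (by omega)).ne'
  have hv : padicValNat b N = i := by
    rw [padicValNat_def' hb1 hN0]
    apply multiplicity_eq_of_dvd_of_not_dvd
    · rw [hM]; exact dvd_mul_right _ _
    · rw [hM, pow_succ]
      exact fun h => hnd (Nat.dvd_of_mul_dvd_mul_left (pow_pos hbpos i) h)
  refine ⟨hv, ?_⟩
  unfold lnzd unitPart
  rw [hv, hM, Nat.mul_div_cancel_left _ (pow_pos hbpos i)]
  have h1 : (q ^ a * (q ^ c * w) + L) % b ≡ q ^ a * (q ^ c * w) + L [MOD q ^ a] :=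
    (Nat.mod_modEq _ b).of_dvd (hb ▸ dvd_mul_right _ _)
  refine h1.trans ?_
  simp [Nat.ModEq]
end
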